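/- arXiv:1806.03447 — 3 statements merged into one kernel-verified Lean document; each statement's English description precedes it below -/
import Mathlib

section
/- Let Γ be a group with trivial center and let G be a finitely generated nilpotent group. Then every automorphism f of the direct product Γ × G has the form f(γ, g) = (α(γ), ρ(γ)·L(g)) for all (γ, g) ∈ Γ × G, where α : Γ → Γ is an automorphism of Γ, L : G → G is an automorphism of G, and ρ : Γ → G is a group homomorphism whose image is contained in the center of G. -/
theorem aux_fst_eq_one {Γ G : Type*} [Group Γ] [Group G]
    (hΓ : Subgroup.center Γ = ⊥) (f : (Γ × G) ≃* (Γ × G)) (n : ℕ) :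
    ∀ g ∈ Subgroup.upperCentralSeries G n, (f (1, g)).1 = 1 := by
  induction n with
  | zero =>
    intro g hg
    have h1 : g = 1 := by simpa using hg
    subst h1
    have : f (1, 1) = 1 := map_one f
    rw [this]; rfl
  | succ n ih =>
    intro g hg
    rw [Subgroup.mem_upperCentralSeries_succ_iff] at hg
    rw [← Subgroup.mem_bot, ← hΓ, Subgroup.mem_center_iff]
    intro c
    obtain ⟨⟨γ, h⟩, hc⟩ := f.surjective (c, 1)
    have h2 := ih _ (hg h)
    have h3 : ((1 : Γ), g * h * g⁻¹ * h⁻¹) = (1, g) * (γ, h) * (1, g)⁻¹ * (γ, h)⁻¹ := by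
      ext <;> simp
    rw [commutatorElement_def, h3, map_mul, map_mul, map_mul, map_inv, map_inv, hc] at h2
    simp only [Prod.fst_mul, Prod.fst_inv] at h2
    rw [mul_inv_eq_one, mul_inv_eq_iff_eq_mul] at h2
    exact h2.symm

/-- Every automorphism of Γ × G, where Γ has trivial center and G is finitely
generated nilpotent, has the model form (γ, g) ↦ (α γ, ρ γ * L g), with
α, L automorphisms and ρ a homomorphism into the center of G. -/
theorem automorphism_model_form
    {Γ G : Type*} [Group Γ] [Group G]
    (hΓ : Subgroup.center Γ = ⊥) [Group.FG G] [Group.IsNilpotent G]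
    (f : (Γ × G) ≃* (Γ × G)) :
    ∃ (α : Γ ≃* Γ) (L : G ≃* G) (ρ : Γ →* G),
      (∀ γ, ρ γ ∈ Subgroup.center G) ∧
      ∀ (γ : Γ) (g : G), f (γ, g) = (α γ, ρ γ * L g) := by
  obtain ⟨n, hn⟩ := Group.IsNilpotent.nilpotent G
  have key : ∀ (e : (Γ × G) ≃* (Γ × G)) (g : G), (e (1, g)).1 = 1 := fun e g =>
    aux_fst_eq_one hΓ e n g (by rw [hn]; trivial)
  have key2 : ∀ (e : (Γ × G) ≃* (Γ × G)) (g : G), e (1, g) = (1, (e (1, g)).2) := fun e g =>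
    Prod.ext (key e g) rfl
  have split : ∀ (γ : Γ) (g : G), f (γ, g) = f (γ, 1) * f (1, g) := by
    intro γ g
    rw [← map_mul]; simp
  have split' : ∀ (γ : Γ) (g : G), f (γ, g) = f (1, g) * f (γ, 1) := by
    intro γ g
    rw [← map_mul]; simp
  let A : Γ →* Γ := (MonoidHom.fst Γ G).comp (f.toMonoidHom.comp (MonoidHom.inl Γ G))
  let ρ : Γ →* G := (MonoidHom.snd Γ G).comp (f.toMonoidHom.comp (MonoidHom.inl Γ G))
  let B : G →* G := (MonoidHom.snd Γ G).comp (f.toMonoidHom.comp (MonoidHom.inr Γ G))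
  have hA : ∀ γ, A γ = (f (γ, 1)).1 := fun _ => rfl
  have hρ : ∀ γ, ρ γ = (f (γ, 1)).2 := fun _ => rfl
  have hB : ∀ g, B g = (f (1, g)).2 := fun _ => rfl
  have bA : Function.Bijective A := by
    constructor
    · rw [injective_iff_map_eq_one]
      intro γ h
      have h1 : f (γ, 1) = (1, (f (γ, 1)).2) := Prod.ext h rfl
      have h2 := key f.symm (f (γ, 1)).2
      rw [← h1, f.symm_apply_apply] at h2
      exact h2
    · intro c
      obtain ⟨⟨γ, h⟩, hc⟩ := f.surjective (c, 1)
      refine ⟨γ, ?_⟩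
      rw [split] at hc
      have := congrArg Prod.fst hc
      simpa [key, hA] using this
  have bB : Function.Bijective B := by
    constructor
    · rw [injective_iff_map_eq_one]
      intro g h
      have h1 : f (1, g) = 1 := Prod.ext (key f g) h
      have h2 := f.map_eq_one_iff.mp h1
      exact congrArg Prod.snd h2
    · intro c
      refine ⟨(f.symm (1, c)).2, ?_⟩
      rw [hB, ← key2 f.symm c, f.apply_symm_apply]
  refine ⟨MulEquiv.ofBijective A bA, MulEquiv.ofBijective B bB, ρ, ?_, ?_⟩
  · intro γ
    rw [Subgroup.mem_center_iff]
    intro c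
    obtain ⟨g, rfl⟩ := bB.2 c
    have := congrArg Prod.snd ((split' γ g).symm.trans (split γ g))
    exact this
  · intro γ g
    rw [split]
    ext
    · simp [key, hA]
    · simp [hρ, hB]
end

section
/- Let Γ be a group with trivial center and let G be a finitely generated nilpotent group. Then every automorphism f of the direct product Γ × G maps the subgroup {1} × G onto itself; that is, the image under f of the subgroup {(1, g) : g ∈ G} equals {(1, g) : g ∈ G}, so f restricts to an automorphism of G. -/
theorem mem_ucs_prod_aux {Γ G : Type*} [Group Γ] [Group G]
    (hΓ : Subgroup.center Γ = ⊥) (n : ℕ) : ∀ p : Γ × G,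
    p ∈ Subgroup.upperCentralSeries (Γ × G) n ↔
      p.1 = 1 ∧ p.2 ∈ Subgroup.upperCentralSeries G n := by
  induction n with
  | zero =>
    intro p
    simp [Subgroup.upperCentralSeries_zero, Subgroup.mem_bot, Prod.ext_iff]
  | succ n ih =>
    intro p
    rw [Subgroup.mem_upperCentralSeries_succ_iff, Subgroup.mem_upperCentralSeries_succ_iff]
    simp only [ih]
    constructor
    · intro h
      refine ⟨?_, fun y => (h (1, y)).2⟩
      have hc : p.1 ∈ Subgroup.center Γ := by
        rw [Subgroup.mem_center_iff]
        intro g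
        have h1 := (h (g, 1)).1
        simp [commutatorElement_def] at h1
        have h2 := mul_inv_eq_one.mp h1
        exact (mul_inv_eq_iff_eq_mul.mp h2).symm
      rw [hΓ] at hc
      exact Subgroup.mem_bot.mp hc
    · rintro ⟨h1, h2⟩ y
      refine ⟨?_, h2 y.2⟩
      simp [commutatorElement_def, h1]

/-- Every automorphism of Γ × G, where Γ has trivial center and G is finitely
generated nilpotent, maps the subgroup {1} × G onto itself. -/
theorem automorphism_preserves_second_factor
    {Γ G : Type*} [Group Γ] [Group G]
    (hΓ : Subgroup.center Γ = ⊥) [Group.FG G] [Group.IsNilpotent G]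
    (f : (Γ × G) ≃* (Γ × G)) :
    Subgroup.map f.toMonoidHom ((⊥ : Subgroup Γ).prod (⊤ : Subgroup G)) =
      (⊥ : Subgroup Γ).prod (⊤ : Subgroup G) := by
  obtain ⟨n, hn⟩ := Group.IsNilpotent.nilpotent G
  have key : (⊥ : Subgroup Γ).prod (⊤ : Subgroup G) =
      Subgroup.upperCentralSeries (Γ × G) n := by
    ext p
    rw [mem_ucs_prod_aux hΓ, hn, Subgroup.mem_prod, Subgroup.mem_bot]
  rw [key]
  exact Subgroup.characteristic_iff_map_eq.mp inferInstance f
end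

section
/- Let Γ be a torsion-free virtually polycyclic group whose center is trivial. Then the intersection of all maximal nilpotent subgroups of Γ is the trivial subgroup. -/
/-- The commutator map `x ↦ x⁻¹ g x g⁻¹`. -/
def auxComm {G : Type*} [Group G] (g x : G) : G := x⁻¹ * (g * x * g⁻¹)

theorem auxComm_eq_one {G : Type*} [Group G] {g x : G} : auxComm g x = 1 ↔ g * x = x * g := by
  unfold auxComm
  rw [inv_mul_eq_one, eq_mul_inv_iff_mul_eq]
  exact eq_comm

theorem auxComm_iter {G : Type*} [Group G] (hG : Group.IsNilpotent G) (g x : G) :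
    ∃ n, (auxComm g)^[n] x = 1 := by
  obtain ⟨n, hn⟩ := Subgroup.nilpotent_iff_lowerCentralSeries.1 hG
  have key : ∀ k, (auxComm g)^[k] x ∈ Subgroup.lowerCentralSeries (⊤ : Subgroup G) k := by
    intro k
    induction k with
    | zero => simp
    | succ k ih =>
      rw [Function.iterate_succ_apply']
      have h := Subgroup.commutator_mem_commutator
        ((Subgroup.lowerCentralSeries (⊤ : Subgroup G) k).inv_mem ih) (Subgroup.mem_top g)
      rw [commutatorElement_def, inv_inv] at h
      have e : auxComm g ((auxComm g)^[k] x) =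
          ((auxComm g)^[k] x)⁻¹ * g * (auxComm g)^[k] x * g⁻¹ := by
        simp [auxComm, mul_assoc]
      rw [e]
      exact h
  refine ⟨n, ?_⟩
  have := key n
  rw [hn] at this
  simpa using this

theorem auxComm_last {G : Type*} [Group G] (N : Subgroup G) (hN : Group.IsNilpotent N)
    {g x : G} (hg : g ∈ N) (hx : x ∈ N) (hx1 : x ≠ 1) :
    ∃ k, (auxComm g)^[k] x ≠ 1 ∧ auxComm g ((auxComm g)^[k] x) = 1 := by
  classical
  have hex : ∃ n, (auxComm g)^[n] x = 1 := by
    obtain ⟨n, hn⟩ := auxComm_iter hN ⟨g, hg⟩ ⟨x, hx⟩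
    refine ⟨n, ?_⟩
    have : ∀ k, (((auxComm (⟨g, hg⟩ : N))^[k] ⟨x, hx⟩ : N) : G) = (auxComm g)^[k] x := by
      intro k
      induction k with
      | zero => rfl
      | succ k ih => rw [Function.iterate_succ_apply', Function.iterate_succ_apply', ← ih]; rfl
    rw [← this, hn]; rfl
  have h1 := Nat.find_spec hex
  rcases h : Nat.find hex with _ | k
  · rw [h] at h1; exact absurd h1 hx1
  · refine ⟨k, Nat.find_min hex (by omega), ?_⟩
    rw [h, Function.iterate_succ_apply'] at h1
    exact h1

theorem aux_mem_iter {G : Type*} [Group G] {g : G} (B : Subgroup G)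
    (hB : ∀ y ∈ B, g * y * g⁻¹ ∈ B) {x : G} (hx : x ∈ B) (k : ℕ) : (auxComm g)^[k] x ∈ B := by
  induction k with
  | zero => exact hx
  | succ k ih =>
    rw [Function.iterate_succ_apply']
    exact B.mul_mem (B.inv_mem ih) (hB _ ih)

/-- existence of a nontrivial element commuting with `g` -/
theorem aux_fixed {G : Type*} [Group G] (N : Subgroup G) (hN : Group.IsNilpotent N)
    {g : G} (hg : g ∈ N) (B : Subgroup G) (hBN : B ≤ N) (hB : ∀ y ∈ B, g * y * g⁻¹ ∈ B)
    (hne : B ≠ ⊥) : ∃ y ∈ B, y ≠ 1 ∧ g * y = y * g := by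
  obtain ⟨x, hx, hx1⟩ := B.bot_or_exists_ne_one.resolve_left hne
  obtain ⟨k, hk, hk'⟩ := auxComm_last N hN hg (hBN hx) hx1
  exact ⟨_, aux_mem_iter B hB hx k, hk, auxComm_eq_one.1 hk'⟩

theorem aux_root {G : Type*} [Group G] (htf : ∀ g : G, g ≠ 1 → ¬IsOfFinOrder g)
    (N : Subgroup G) (hN : Group.IsNilpotent N) {g x : G} (hg : g ∈ N) (hx : x ∈ N)
    {m : ℕ} (hm : 0 < m) (hc : g ^ m * x = x * g ^ m) : g * x = x * g := by
  by_contra hne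
  have h1 : auxComm g x ≠ 1 := fun h => hne (auxComm_eq_one.1 h)
  have hfx : auxComm g x ∈ N :=
    N.mul_mem (N.inv_mem hx) (N.mul_mem (N.mul_mem hg hx) (N.inv_mem hg))
  obtain ⟨k, hk, hk'⟩ := auxComm_last N hN hg hfx h1
  rw [← Function.iterate_succ_apply, Function.iterate_succ_apply'] at hk hk'
  have hy : (auxComm g)^[k] x ∈ Subgroup.centralizer {g ^ m} := by
    apply aux_mem_iter
    · intro y hy
      rw [Subgroup.mem_centralizer_singleton_iff] at hy ⊢
      have a : Commute y (g ^ m) := hy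
      have b : Commute g (g ^ m) := Commute.self_pow g m
      exact (b.mul_left a).mul_left b.inv_left
    · rw [Subgroup.mem_centralizer_singleton_iff]; exact hc.symm
  rw [Subgroup.mem_centralizer_singleton_iff] at hy
  generalize (auxComm g)^[k] x = y at *
  obtain ⟨c, hcdef⟩ : ∃ c, auxComm g y = c := ⟨_, rfl⟩
  rw [hcdef] at hk hk'
  have hgc := auxComm_eq_one.1 hk'
  have hgy : g * y = y * c * g := by rw [← hcdef]; simp [auxComm]
  have hpow : ∀ j : ℕ, g ^ j * y = y * c ^ j * g ^ j := by
    intro j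
    induction j with
    | zero => simp
    | succ j ih =>
      have hcj : g * c ^ j = c ^ j * g := (show Commute g c from hgc).pow_right j
      calc g ^ (j+1) * y = g * (g ^ j * y) := by rw [pow_succ', mul_assoc]
        _ = (g * y) * c ^ j * g ^ j := by rw [ih]; simp only [mul_assoc]
        _ = y * c * (g * c ^ j) * g ^ j := by rw [hgy]; simp only [mul_assoc]
        _ = y * c ^ (j+1) * g ^ (j+1) := by rw [hcj, pow_succ', pow_succ']; simp only [mul_assoc]
  have h2 := hpow m
  rw [← hy] at h2
  have h3 : c ^ m = 1 := by simpa using h2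
  exact htf c hk (isOfFinOrder_iff_pow_eq_one.2 ⟨m, hm, h3⟩)

theorem aux_fg {G : Type*} [Group G] (H : Subgroup G) (hH : H.FiniteIndex)
    (hfg : ∀ K : Subgroup H, K.FG) (U : Subgroup G) : ∃ S : Set G, S.Finite ∧
      Subgroup.closure S = U := by
  obtain ⟨S, hS⟩ := hfg (U.subgroupOf H)
  have hS' : Subgroup.closure (Set.image H.subtype (S : Set H)) = U ⊓ H := by
    rw [← MonoidHom.map_closure, hS, Subgroup.subgroupOf_map_subtype]
  have hfin : Finite (G ⧸ H) := inferInstance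
  classical
  let r : G ⧸ H → G := fun q => if h : ∃ u ∈ U, (u : G ⧸ H) = q then h.choose else 1
  have hr : ∀ q, r q ∈ U := by
    intro q
    by_cases h : ∃ u ∈ U, (u : G ⧸ H) = q
    · simp only [r, dif_pos h]; exact h.choose_spec.1
    · simp only [r, dif_neg h]; exact U.one_mem
  refine ⟨Set.image H.subtype (S : Set H) ∪ Set.range r,
    (S.finite_toSet.image _).union (Set.finite_range r), le_antisymm ?_ ?_⟩
  · rw [Subgroup.closure_union, sup_le_iff, hS', Subgroup.closure_le]
    refine ⟨inf_le_left, ?_⟩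
    rintro _ ⟨q, rfl⟩
    exact hr q
  · intro u hu
    have h : ∃ v ∈ U, (v : G ⧸ H) = (u : G ⧸ H) := ⟨u, hu, rfl⟩
    have hq : (r u : G ⧸ H) = (u : G ⧸ H) := by
      simp only [r, dif_pos h]; exact h.choose_spec.2
    have hmem : (r u)⁻¹ * u ∈ U ⊓ H :=
      ⟨U.mul_mem (U.inv_mem (hr _)) hu, QuotientGroup.eq.1 hq⟩
    rw [Subgroup.closure_union, hS']
    have := Subgroup.mul_mem_sup (Subgroup.subset_closure (Set.mem_range_self (f := r) (u : G ⧸ H))) hmem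
    rw [mul_inv_cancel_left, sup_comm] at this
    exact this

theorem aux_exists_max {G : Type*} [Group G] (H : Subgroup G) (hH : H.FiniteIndex)
    (hfg : ∀ K : Subgroup H, K.FG) (g : G) : ∃ N : Subgroup G, g ∈ N ∧ Group.IsNilpotent N ∧
      ∀ K : Subgroup G, Group.IsNilpotent K → N ≤ K → K = N := by
  have h0 : Group.IsNilpotent (Subgroup.zpowers g) := by
    apply Subgroup.nilpotent_iff_lowerCentralSeries.2
    refine ⟨1, ?_⟩
    show ⁅(⊤ : Subgroup (Subgroup.zpowers g)), ⊤⁆ = ⊥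
    rw [eq_bot_iff, Subgroup.commutator_le]
    intro a _ b _
    rw [Subgroup.mem_bot, commutatorElement_eq_one_iff_mul_comm]
    exact mul_comm' a b
  obtain ⟨N, hN1, hN2⟩ := zorn_le_nonempty₀ {N : Subgroup G | Group.IsNilpotent N} (by
    intro c hc hch y hy
    obtain ⟨S, hSf, hS⟩ := aux_fg H hH hfg (sSup c)
    have hsub : S ⊆ ⋃ K ∈ c, (K : Set G) := by
      intro s hs
      have : s ∈ sSup c := hS ▸ Subgroup.subset_closure hs
      rw [Subgroup.mem_sSup_of_directedOn ⟨y, hy⟩ hch.directedOn] at this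
      simpa using this
    have : ∃ K ∈ c, S ⊆ K := by
      exact DirectedOn.exists_mem_subset_of_finset_subset_biUnion ⟨y, hy⟩ 
        (s := hSf.toFinset) (f := fun K : Subgroup G => (K : Set G)) hch.directedOn (by simpa using hsub) |>.imp (by simp)
    obtain ⟨K, hK, hSK⟩ := this
    refine ⟨K, hc hK, fun z hz => (le_sSup hz).trans ?_⟩
    rw [← hS, Subgroup.closure_le]
    exact hSK) (Subgroup.zpowers g) h0
  exact ⟨N, hN1 (Subgroup.mem_zpowers g), hN2.prop, fun K hK hle =>
    le_antisymm (hN2.le_of_ge hK hle) hle⟩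

/-- If Γ is a torsion-free virtually polycyclic group with trivial center,
then the intersection of all maximal nilpotent subgroups of Γ is trivial. -/
theorem sInf_maximal_nilpotent_trivial_of_center_trivial
    {Γ : Type*} [Group Γ]
    (htf : ∀ g : Γ, g ≠ 1 → ¬IsOfFinOrder g)
    (hvp : ∃ H : Subgroup Γ, H.FiniteIndex ∧ IsSolvable ↥H ∧ ∀ K : Subgroup ↥H, K.FG)
    (hc : Subgroup.center Γ = ⊥) :
    sInf {N : Subgroup Γ | Group.IsNilpotent ↥N ∧
        ∀ K : Subgroup Γ, Group.IsNilpotent ↥K → N ≤ K → K = N} = ⊥ := by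
  obtain ⟨H, hH, hsol, hfg⟩ := hvp
  set I := sInf {N : Subgroup Γ | Group.IsNilpotent ↥N ∧
        ∀ K : Subgroup Γ, Group.IsNilpotent ↥K → N ≤ K → K = N} with hI
  by_contra hne
  have hmax : ∀ g : Γ, ∃ N : Subgroup Γ, g ∈ N ∧ Group.IsNilpotent N ∧ I ≤ N := by
    intro g
    obtain ⟨N, h1, h2, h3⟩ := aux_exists_max H hH hfg g
    exact ⟨N, h1, h2, sInf_le ⟨h2, h3⟩⟩
  have hnil : ∀ (e : Γ ≃* Γ) (N : Subgroup Γ), Group.IsNilpotent N →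
      Group.IsNilpotent (N.map e.toMonoidHom) := fun e N hN =>
    Group.nilpotent_of_mulEquiv (e.subgroupMap N)
  have hconj : ∀ g : Γ, ∀ x ∈ I, g * x * g⁻¹ ∈ I := by
    intro g x hx
    rw [hI, Subgroup.mem_sInf] at hx ⊢
    rintro N ⟨hN, hN'⟩
    have := hx (N.map (MulAut.conj g⁻¹).toMonoidHom) ⟨hnil _ _ hN, by
      intro K hK hle
      have h1 := hN' (K.map (MulAut.conj g).toMonoidHom) (hnil _ _ hK) (by
        intro n hn
        refine ⟨g⁻¹ * n * g, hle ⟨n, hn, by simp⟩, by simp [mul_assoc]⟩)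
      refine le_antisymm ?_ hle
      intro k hk
      refine ⟨g * k * g⁻¹, ?_, by simp [mul_assoc]⟩
      show g * k * g⁻¹ ∈ N
      rw [← h1]
      exact ⟨k, hk, by simp⟩⟩
    obtain ⟨n, hn, rfl⟩ := this
    simpa [mul_assoc] using hn
  -- the derived series
  let D : ℕ → Subgroup Γ := fun k => (derivedSeries H k).map H.subtype
  have hstep : ∀ k, I ⊓ Subgroup.centralizer (D (k+1) : Set Γ) ≠ ⊥ →
      I ⊓ Subgroup.centralizer (D k : Set Γ) ≠ ⊥ := by
    intro k hk
    obtain ⟨S, hSf, hS⟩ := aux_fg H hH hfg (D k)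
    have hDcomm : D (k+1) = ⁅D k, D k⁆ := by
      simp only [D, derivedSeries_succ, Subgroup.map_commutator]
    have hind : ∀ T : Set Γ, T.Finite → T ⊆ S →
        I ⊓ Subgroup.centralizer (D (k+1) : Set Γ) ⊓ Subgroup.centralizer T ≠ ⊥ := by
      intro T hT
      induction T, hT using Set.Finite.induction_on with
      | empty => 
        intro _
        have : Subgroup.centralizer (∅ : Set Γ) = ⊤ := by
          rw [eq_top_iff]
          exact fun x _ => Subgroup.mem_centralizer_iff.2 fun d hd => absurd hd (Set.notMem_empty d)
        rw [this, inf_top_eq]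
        exact hk
      | @insert g T _ _ ih =>
        intro hsub
        have hgS : g ∈ D k := hS ▸ Subgroup.subset_closure (hsub (Set.mem_insert _ _))
        have hTD : ∀ t ∈ T, t ∈ D k := fun t ht =>
          hS ▸ Subgroup.subset_closure (hsub (Set.mem_insert_of_mem _ ht))
        obtain ⟨N, hgN, hN, hIN⟩ := hmax g
        obtain ⟨y, hy, hy1, hyg⟩ := aux_fixed N hN hgN _
          ((inf_le_left.trans inf_le_left).trans hIN) (by
            rintro y ⟨⟨hyI, hyD⟩, hyT⟩
            have hyD' : ∀ d ∈ D (k+1), d * y = y * d := Subgroup.mem_centralizer_iff.1 hyD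
            have hyT' : ∀ d ∈ T, d * y = y * d := Subgroup.mem_centralizer_iff.1 hyT
            -- transfer of the commuting relation
            have tr : ∀ d, (g⁻¹ * d * g) * y = y * (g⁻¹ * d * g) →
                d * (g * y * g⁻¹) = (g * y * g⁻¹) * d := by
              intro d h
              calc d * (g * y * g⁻¹) = g * ((g⁻¹ * d * g) * y) * g⁻¹ := by group
                _ = g * (y * (g⁻¹ * d * g)) * g⁻¹ := by rw [h]
                _ = _ := by group
            have com : ∀ d ∈ D k, g⁻¹ * d * g * d⁻¹ ∈ D (k+1) := by
              intro d hd
              rw [hDcomm]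
              have := Subgroup.commutator_mem_commutator ((D k).inv_mem hgS) hd
              simpa [commutatorElement_def] using this
            have hle : D (k+1) ≤ D k := Subgroup.map_mono (derivedSeries_antitone H (Nat.le_succ k))
            have conv : ∀ d ∈ D k, d * y = y * d →
                (g⁻¹ * d * g) * y = y * (g⁻¹ * d * g) := by
              intro d hd h
              have h1 : Commute (g⁻¹ * d * g * d⁻¹) y := hyD' _ (com d hd)
              have h2 : Commute d y := h
              have h3 := h1.mul_left h2
              rw [inv_mul_cancel_right] at h3
              exact h3
            refine ⟨⟨hconj g y hyI, ?_⟩, ?_⟩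
            · exact Subgroup.mem_centralizer_iff.2 fun d hd =>
                tr d (conv d (hle hd) (hyD' d hd))
            · exact Subgroup.mem_centralizer_iff.2 fun d hd =>
                tr d (conv d (hTD d hd) (hyT' d hd)))
          (ih ((Set.subset_insert _ _).trans hsub))
        intro hbot
        apply hy1
        rw [← Subgroup.mem_bot, ← hbot]
        refine ⟨hy.1, Subgroup.mem_centralizer_iff.2 ?_⟩
        rintro t (rfl | ht)
        · exact hyg
        · exact Subgroup.mem_centralizer_iff.1 hy.2 t ht
    intro hbot
    apply hind S hSf subset_rfl
    rw [eq_bot_iff, ← hbot, ← hS, Subgroup.centralizer_closure]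
    exact inf_le_inf_right _ inf_le_left
  have hall : ∀ k, I ⊓ Subgroup.centralizer (D k : Set Γ) ≠ ⊥ →
      I ⊓ Subgroup.centralizer (D 0 : Set Γ) ≠ ⊥ := by
    intro k
    induction k with
    | zero => exact id
    | succ k ih => exact fun h => ih (hstep k h)
  obtain ⟨n, hn⟩ := hsol.solvable
  have h0 := hall n (by
    have : D n = ⊥ := by simp only [D, hn, Subgroup.map_bot]
    rw [this]
    intro hbot
    apply hne
    rw [eq_bot_iff, ← hbot]
    refine le_inf le_rfl fun x _ => Subgroup.mem_centralizer_iff.2 ?_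
    rintro d hd
    have : d = 1 := by simpa using hd
    simp [this])
  have hD0 : D 0 = H := by
    simp only [D, derivedSeries_zero, ← MonoidHom.range_eq_map, Subgroup.range_subtype]
  rw [hD0] at h0
  apply h0
  rw [eq_bot_iff, ← hc]
  rintro x ⟨hxI, hxH⟩
  rw [Subgroup.mem_center_iff]
  intro g
  obtain ⟨N, hgN, hN, hIN⟩ := hmax g
  obtain ⟨m, hm, -, hmH⟩ := Subgroup.exists_pow_mem_of_index_ne_zero hH.index_ne_zero g
  exact aux_root htf N hN hgN (hIN hxI) hm (Subgroup.mem_centralizer_iff.1 hxH _ hmH)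
end
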